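/- Let n ≥ 3, and let A₁, A₂, ..., A₂ₙ be 2n distinct points of ℙ²(ℂ) lying on an irreducible conic 𝒞. Let 𝒬₁ and 𝒬₂ be two curves of degree n, given by homogeneous degree-n polynomials with no common nonconstant factor, each passing through all 2n points, and suppose their common zero set consists of exactly n² distinct points: the 2n given points together with n² − 2n further points. Then there exists a nonzero homogeneous polynomial of some degree d ≤ n − 2 which vanishes at all of the n² − 2n further intersection points. -/

import Mathlib

open MvPolynomial

noncomputable section

/-- Polynomials in three variables over `ℂ`. -/
abbrev Poly3 : Type := MvPolynomial (Fin 3) ℂ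

/-- The complex projective plane `ℙ²(ℂ)`, the projectivization of `ℂ³`. -/
abbrev ProjPlane : Type := Projectivization ℂ (Fin 3 → ℂ)

/-- A (homogeneous) polynomial vanishes at a projective point if it vanishes at its
canonical nonzero representative vector (for homogeneous polynomials this is equivalent
to vanishing at any nonzero representative vector). -/
def VanishesAt (F : Poly3) (p : ProjPlane) : Prop :=
  MvPolynomial.eval p.rep F = 0

/-- The set of points of `ℙ²(ℂ)` at which `F` vanishes. -/
def zeroSet (F : Poly3) : Set ProjPlane := {p | VanishesAt F p}

/-- Two defining polynomials give the same curve iff they are proportional by a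
nonzero scalar. -/
def ProportionalTo (F G : Poly3) : Prop := ∃ c : ℂ, c ≠ 0 ∧ G = c • F

/-- A set of points is collinear if some nonzero homogeneous polynomial of degree 1
vanishes at all of them. -/
def Collin (s : Set ProjPlane) : Prop :=
  ∃ L : Poly3, L ≠ 0 ∧ L.IsHomogeneous 1 ∧ ∀ p ∈ s, VanishesAt L p

/-- No three distinct points of `s` are collinear. -/
def NoThreeCollinear (s : Set ProjPlane) : Prop :=
  ∀ p q r, p ∈ s → q ∈ s → r ∈ s → p ≠ q → p ≠ r → q ≠ r → ¬ Collin {p, q, r}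

/-- `L` is a (the) line through the points `p` and `q`. -/
def IsLineThrough (L : Poly3) (p q : ProjPlane) : Prop :=
  L ≠ 0 ∧ L.IsHomogeneous 1 ∧ VanishesAt L p ∧ VanishesAt L q

/-- `L` is the generalized Pascal line of the cubics `D₁` and `D₂` with respect to six
points `A, …, F`: the cubics have no common nonconstant factor, their common zero set
consists of exactly nine distinct points (the six given ones plus three further points),
and `L` is the line through the three further intersection points. -/
def IsGenPascalLine (A B C D E F : ProjPlane) (D₁ D₂ L : Poly3) : Prop :=
  IsRelPrime D₁ D₂ ∧ L ≠ 0 ∧ L.IsHomogeneous 1 ∧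
    ∃ P Q R : ProjPlane,
      ([A, B, C, D, E, F, P, Q, R] : List ProjPlane).Pairwise (· ≠ ·) ∧
      zeroSet D₁ ∩ zeroSet D₂ = {A, B, C, D, E, F, P, Q, R} ∧
      VanishesAt L P ∧ VanishesAt L Q ∧ VanishesAt L R

section Plane

open Module

/-- Evaluating a homogeneous polynomial of degree `n` at `c • v` scales its value by `c ^ n`. -/
lemma eval_smul_of_isHomogeneous {F : Poly3} {n : ℕ} (hF : F.IsHomogeneous n) (c : ℂ)
    (v : Fin 3 → ℂ) : eval (c • v) F = c ^ n * eval v F := by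
  induction hF using IsWeightedHomogeneous.induction_on with
  | zero => simp
  | add p q _ _ hp hq => rw [map_add, map_add, hp, hq, mul_add]
  | monomial d r hr =>
    rw [← hr, Finsupp.weight_apply, Finsupp.sum, eval_monomial, eval_monomial, Finsupp.prod,
      Finsupp.prod]
    simp only [Pi.smul_apply, smul_eq_mul, mul_pow, Finset.prod_mul_distrib, Pi.one_apply, mul_one,
      Finset.prod_pow_eq_pow_sum]
    ring

/-- The homogeneous polynomial of degree one with the same values as the linear form `f`. -/
def linPoly (f : Dual ℂ (Fin 3 → ℂ)) : Poly3 := ∑ i, C (f (Pi.single i 1)) * X i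

lemma eval_linPoly (f : Dual ℂ (Fin 3 → ℂ)) (v : Fin 3 → ℂ) : eval v (linPoly f) = f v := by
  conv_rhs => rw [pi_eq_sum_univ' v]
  simp [linPoly, mul_comm, Pi.single]

lemma isHomogeneous_linPoly (f : Dual ℂ (Fin 3 → ℂ)) : (linPoly f).IsHomogeneous 1 :=
  IsHomogeneous.sum _ _ _ fun i _ => isHomogeneous_C_mul_X _ i

lemma linPoly_ne_zero {f : Dual ℂ (Fin 3 → ℂ)} (hf : f ≠ 0) : linPoly f ≠ 0 := by
  contrapose! hf
  ext1 v
  ext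
  simp [← eval_linPoly, hf]

lemma totalDegree_linPoly {f : Dual ℂ (Fin 3 → ℂ)} (hf : f ≠ 0) :
    (linPoly f).totalDegree = 1 :=
  (isHomogeneous_linPoly f).totalDegree (linPoly_ne_zero hf)

lemma irreducible_linPoly {f : Dual ℂ (Fin 3 → ℂ)} (hf : f ≠ 0) : Irreducible (linPoly f) := by
  refine irreducible_of_totalDegree_eq_one (totalDegree_linPoly hf) fun x hx => ?_
  rw [isUnit_iff_ne_zero]
  rintro rfl
  exact linPoly_ne_zero hf (by ext i; simpa using hx i)

/-- The Nullstellensatz for an irreducible hypersurface. -/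
lemma Irreducible.dvd_of_forall_eval_eq_zero {K F : Poly3} (hK : Irreducible K)
    (h : ∀ v, eval v K = 0 → eval v F = 0) : K ∣ F := by
  have : (Ideal.span {K}).IsPrime := (Ideal.span_singleton_prime hK.ne_zero).2 hK.prime
  rw [← Ideal.mem_span_singleton, ← IsPrime.vanishingIdeal_zeroLocus (K := ℂ) (Ideal.span {K}),
    mem_vanishingIdeal_iff]
  intro v hv
  rw [aeval_eq_eval]
  refine h v ?_
  simpa [aeval_eq_eval] using hv K (Ideal.mem_span_singleton_self K)

/-- An irreducible conic contains no line. -/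
lemma exists_eval_ne_zero_of_linear {K : Poly3} (hKh : K.IsHomogeneous 2) (hK : Irreducible K)
    {f : Dual ℂ (Fin 3 → ℂ)} (hf : f ≠ 0) : ∃ v, f v = 0 ∧ eval v K ≠ 0 := by
  by_contra! h
  obtain ⟨N, hN⟩ : linPoly f ∣ K :=
    (irreducible_linPoly hf).dvd_of_forall_eval_eq_zero fun v hv => h v (by rwa [← eval_linPoly])
  have hN0 : N ≠ 0 := by
    rintro rfl
    exact hK.ne_zero (by simpa using hN)
  have hdeg := hKh.totalDegree hK.ne_zero
  rw [hN, totalDegree_mul_of_isDomain (linPoly_ne_zero hf) hN0, totalDegree_linPoly hf] at hdeg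
  rcases hK.isUnit_or_isUnit hN with hu | hu
  · exact (irreducible_linPoly hf).not_isUnit hu
  · have := (isUnit_iff_totalDegree_of_isReduced.mp hu).2
    omega

/-- A homogeneous polynomial of degree two comes from a bilinear form. -/
lemma exists_bilin_of_isHomogeneous_two {K : Poly3} (hK : K.IsHomogeneous 2) :
    ∃ B : LinearMap.BilinForm ℂ (Fin 3 → ℂ), ∀ v, eval v K = B v v := by
  rw [← mem_homogeneousSubmodule, ← homogeneousSubmodule_one_pow, pow_two] at hK
  induction hK using Submodule.mul_induction_on' with
  | mem_mul_mem p hp q hq =>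
    have key : ∀ r ∈ homogeneousSubmodule (Fin 3) ℂ 1, ∃ f : Dual ℂ (Fin 3 → ℂ),
        ∀ v, eval v r = f v := by
      intro r hr
      rw [homogeneousSubmodule_one_eq_span_X] at hr
      induction hr using Submodule.span_induction with
      | mem x hx =>
        obtain ⟨i, rfl⟩ := hx
        exact ⟨LinearMap.proj i, fun v => by simp⟩
      | zero => exact ⟨0, fun v => by simp⟩
      | add x y _ _ hx hy =>
        obtain ⟨f, hf⟩ := hx
        obtain ⟨g, hg⟩ := hy
        exact ⟨f + g, fun v => by simp [hf, hg]⟩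
      | smul c x _ hx =>
        obtain ⟨f, hf⟩ := hx
        exact ⟨c • f, fun v => by simp [hf]⟩
    obtain ⟨f, hf⟩ := key p hp
    obtain ⟨g, hg⟩ := key q hq
    exact ⟨f.smulRight g, fun v => by simp [hf, hg]⟩
  | add x _ y _ hx hy =>
    obtain ⟨f, hf⟩ := hx
    obtain ⟨g, hg⟩ := hy
    exact ⟨f + g, fun v => by simp [hf, hg]⟩

lemma exists_ne_zero_binary_quadratic_eq_zero (a b c : ℂ) :
    ∃ y z : ℂ, (y ≠ 0 ∨ z ≠ 0) ∧ a * y ^ 2 + b * (y * z) + c * z ^ 2 = 0 := by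
  by_cases ha : a = 0
  · exact ⟨1, 0, by simp, by simp [ha]⟩
  · obtain ⟨s, hs⟩ := IsAlgClosed.exists_pow_nat_eq (discrim a b c) two_pos
    obtain ⟨x, hx⟩ := exists_quadratic_eq_zero ha ⟨s, by rw [← hs, sq]⟩
    exact ⟨x, 1, by simp, by linear_combination hx⟩

/-- A nonzero vector of `ℂ³` is the first vector of some basis. -/
lemma exists_basis_zero_eq {p : Fin 3 → ℂ} (hp : p ≠ 0) :
    ∃ e : Basis (Fin 3) ℂ (Fin 3 → ℂ), e 0 = p := by
  have hs : LinearIndepOn ℂ id {p} := LinearIndepOn.singleton hp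
  let b := Basis.extend hs
  let i₀ : hs.extend (Set.subset_univ _) := ⟨p, hs.subset_extend _ rfl⟩
  let σ := b.indexEquiv (Pi.basisFun ℂ (Fin 3))
  refine ⟨b.reindex (σ.trans (Equiv.swap (σ i₀) 0)), ?_⟩
  simp [Basis.reindex_apply, b, i₀]

/-- The parametrization of an irreducible conic by the pencil of lines through one of its
points `p`. -/
lemma exists_conic_parametrization {K : Poly3} (hKh : K.IsHomogeneous 2) (hK : Irreducible K)
    {p : Fin 3 → ℂ} (hp : p ≠ 0) (hpK : eval p K = 0) :
    ∃ (a b : Fin 3 → ℂ) (q : Polynomial ℂ), q.natDegree ≤ 2 ∧ LinearIndependent ℂ ![p, a, b] ∧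
      (∀ s : ℂ, eval (a + s • b + q.eval s • p) K = 0) ∧
      ∀ v, eval v K = 0 → (∃ c : ℂ, v = c • p) ∨
        ∃ c s : ℂ, c ≠ 0 ∧ v = c • (a + s • b + q.eval s • p) := by
  obtain ⟨B, hB⟩ := exists_bilin_of_isHomogeneous_two hKh
  have hBp : B p p = 0 := by rw [← hB, hpK]
  set L : Dual ℂ (Fin 3 → ℂ) := B p + B.flip p with hL
  have hLv : ∀ v, L v = B p v + B v p := fun v => by simp [hL]
  have hL0 : L ≠ 0 := by
    intro hL0
    obtain ⟨e, he⟩ := exists_basis_zero_eq hp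
    have hv : ∀ v, eval v K = B (e 1) (e 1) * e.coord 1 v ^ 2
        + (B (e 1) (e 2) + B (e 2) (e 1)) * (e.coord 1 v * e.coord 2 v)
        + B (e 2) (e 2) * e.coord 2 v ^ 2 := by
      intro v
      have hs := e.sum_repr v
      rw [Fin.sum_univ_three, he] at hs
      have h1 := hLv (e 1)
      have h2 := hLv (e 2)
      rw [hL0] at h1 h2
      simp only [LinearMap.zero_apply] at h1 h2
      rw [hB]
      conv_lhs => rw [← hs]
      simp only [map_add, map_smul, LinearMap.add_apply, LinearMap.smul_apply, smul_eq_mul,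
        Basis.coord_apply, hBp]
      linear_combination (-(e.repr v 0 * e.repr v 1)) * h1 - (e.repr v 0 * e.repr v 2) * h2
    obtain ⟨y, z, hyz, h0⟩ := exists_ne_zero_binary_quadratic_eq_zero (B (e 1) (e 1))
      (B (e 1) (e 2) + B (e 2) (e 1)) (B (e 2) (e 2))
    obtain ⟨v, hfv, hKv⟩ := exists_eval_ne_zero_of_linear hKh hK
      (f := z • e.coord 1 - y • e.coord 2) (by
        intro hf
        have h1 := LinearMap.congr_fun hf (e 1)
        have h2 := LinearMap.congr_fun hf (e 2)
        simp at h1 h2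
        tauto)
    have hfv' : z * e.coord 1 v = y * e.coord 2 v := by
      simpa [sub_eq_zero] using hfv
    rw [hv] at hKv
    rcases hyz with h | h
    · refine hKv ((mul_eq_zero.1 ?_).resolve_left (pow_ne_zero 2 h))
      linear_combination e.coord 1 v ^ 2 * h0
        - ((B (e 1) (e 2) + B (e 2) (e 1)) * y * e.coord 1 v
          + B (e 2) (e 2) * (y * e.coord 2 v + z * e.coord 1 v)) * hfv'
    · refine hKv ((mul_eq_zero.1 ?_).resolve_left (pow_ne_zero 2 h))
      linear_combination e.coord 2 v ^ 2 * h0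
        + ((B (e 1) (e 2) + B (e 2) (e 1)) * z * e.coord 2 v
          + B (e 1) (e 1) * (y * e.coord 2 v + z * e.coord 1 v)) * hfv'
  have hLp : L p = 0 := by rw [hLv, hBp, add_zero]
  obtain ⟨b, hLb, hKb⟩ := exists_eval_ne_zero_of_linear hKh hK hL0
  obtain ⟨a, hLa⟩ : ∃ a, L a = 1 := by
    obtain ⟨w, hw⟩ := DFunLike.ne_iff.1 hL0
    exact ⟨(L w)⁻¹ • w, by simpa using inv_mul_cancel₀ hw⟩
  have hexp : ∀ x y z : ℂ, eval (x • p + y • a + z • b) K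
      = x * y + (B a a * y ^ 2 + (B a b + B b a) * (y * z) + B b b * z ^ 2) := by
    intro x y z
    have h1 := hLv a
    have h2 := hLv b
    rw [hLa] at h1
    rw [hLb] at h2
    rw [hB]
    simp only [map_add, map_smul, LinearMap.add_apply, LinearMap.smul_apply, smul_eq_mul, hBp]
    linear_combination (-(x * y)) * h1 - (x * z) * h2
  rw [hB] at hKb
  have hli : LinearIndependent ℂ ![p, a, b] := by
    rw [Fintype.linearIndependent_iff]
    intro g hg
    simp only [Fin.sum_univ_three, Matrix.cons_val] at hg
    have h1 : g 1 = 0 := by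
      have := congrArg L hg
      simpa [hLp, hLa, hLb] using this
    have h2 : g 2 = 0 := by
      have := hexp (g 0) (g 1) (g 2)
      rw [hg, h1, hB] at this
      simpa [hKb] using this
    have h0 : g 0 = 0 := by
      rw [h1, h2] at hg
      simpa [hp] using hg
    intro i
    fin_cases i <;> assumption
  let q : Polynomial ℂ := -(Polynomial.C (B b b) * Polynomial.X ^ 2
    + Polynomial.C (B a b + B b a) * Polynomial.X + Polynomial.C (B a a))
  have hq : ∀ s, q.eval s = -(B a a + (B a b + B b a) * s + B b b * s ^ 2) := by
    intro s
    simp [q]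
    ring
  refine ⟨a, b, q, ?_, hli, fun s => ?_, fun v hv => ?_⟩
  · rw [Polynomial.natDegree_neg]
    exact Polynomial.natDegree_quadratic_le
  · rw [show a + s • b + q.eval s • p = q.eval s • p + (1 : ℂ) • a + s • b by module, hexp, hq]
    ring
  · let e := basisOfLinearIndependentOfCardEqFinrank hli (by simp)
    have hs := e.sum_repr v
    simp only [Fin.sum_univ_three, e, coe_basisOfLinearIndependentOfCardEqFinrank,
      Matrix.cons_val] at hs
    generalize (basisOfLinearIndependentOfCardEqFinrank hli _).repr v 0 = x at hs
    generalize (basisOfLinearIndependentOfCardEqFinrank hli _).repr v 1 = y at hs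
    generalize (basisOfLinearIndependentOfCardEqFinrank hli _).repr v 2 = z at hs
    subst hs
    rw [hexp] at hv
    by_cases hy : y = 0
    · subst hy
      have hz : z = 0 := by simpa [hKb] using hv
      exact Or.inl ⟨x, by simp [hz]⟩
    · refine Or.inr ⟨y, z / y, hy, ?_⟩
      have hx : x = y * q.eval (z / y) := by
        rw [hq]
        field_simp
        linear_combination hv
      rw [smul_add, smul_add, smul_smul, smul_smul, ← hx, mul_div_cancel₀ _ hy]
      module

/-- Proportional points of the parametrization have the same parameter. -/
lemma parametrization_injective {p a b : Fin 3 → ℂ} (hli : LinearIndependent ℂ ![p, a, b])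
    {c s t x y : ℂ} (h : a + s • b + x • p = c • (a + t • b + y • p)) : s = t := by
  have h0 := Fintype.linearIndependent_iff.1 hli ![x - c * y, 1 - c, s - c * t] (by
    simp only [Fin.sum_univ_three, Matrix.cons_val]
    rw [← sub_eq_zero.2 h]
    module)
  have h1 := h0 1
  have h2 := h0 2
  simp only [Matrix.cons_val] at h1 h2
  linear_combination h2 - t * h1

lemma vanishesAt_mk {F : Poly3} {n : ℕ} (hF : F.IsHomogeneous n) {v : Fin 3 → ℂ} (hv : v ≠ 0)
    (h : eval v F = 0) : VanishesAt F (Projectivization.mk ℂ v hv) := by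
  obtain ⟨c, hc⟩ := Projectivization.exists_smul_eq_mk_rep ℂ v hv
  rw [VanishesAt, ← hc, Units.smul_def, eval_smul_of_isHomogeneous hF, h, mul_zero]

/-- An irreducible conic has infinitely many points as soon as it has one. -/
lemma infinite_zeroSet {K : Poly3} (hKh : K.IsHomogeneous 2) (hK : Irreducible K) {p : ProjPlane}
    (hp : VanishesAt K p) : (zeroSet K).Infinite := by
  obtain ⟨a, b, q, -, hli, hg, -⟩ := exists_conic_parametrization hKh hK p.rep_nonzero hp
  have hne : ∀ s : ℂ, a + s • b + q.eval s • p.rep ≠ 0 := by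
    intro s hs
    have h0 := Fintype.linearIndependent_iff.1 hli ![q.eval s, 1, s] (by
      simp only [Fin.sum_univ_three, Matrix.cons_val]
      rw [← hs]
      module)
    simpa using h0 1
  refine Set.infinite_of_injective_forall_mem
    (f := fun s : ℂ => Projectivization.mk ℂ _ (hne s)) (fun s t hst => ?_)
    fun s => vanishesAt_mk hKh (hne s) (hg s)
  obtain ⟨c, hc⟩ := (Projectivization.mk_eq_mk_iff' ℂ _ _ _ _).1 hst
  exact parametrization_injective hli hc.symm

lemma exists_dual_ne_zero_apply_eq_zero {p : Fin 3 → ℂ} (hp : p ≠ 0) :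
    ∃ f : Dual ℂ (Fin 3 → ℂ), f ≠ 0 ∧ f p = 0 := by
  obtain ⟨e, rfl⟩ := exists_basis_zero_eq hp
  refine ⟨e.coord 1, fun h => ?_, by simp⟩
  simpa using LinearMap.congr_fun h (e 1)

/-- A curve of degree `n` meeting an irreducible conic in more than `2n` points contains it. -/
lemma conic_dvd_of_card_lt {K : Poly3} (hKh : K.IsHomogeneous 2) (hK : Irreducible K) {F : Poly3}
    {n : ℕ} (hF : F.IsHomogeneous n) (T : Finset ProjPlane) (hT : 2 * n < T.card)
    (hTK : ∀ t ∈ T, VanishesAt K t) (hTF : ∀ t ∈ T, VanishesAt F t) : K ∣ F := by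
  obtain ⟨t₀, ht₀⟩ : T.Nonempty := Finset.card_pos.1 (by omega)
  obtain ⟨p, hpK, hpT⟩ := (infinite_zeroSet hKh hK (hTK t₀ ht₀)).exists_notMem_finset T
  obtain ⟨a, b, q, hq, hli, -, hpar⟩ := exists_conic_parametrization hKh hK p.rep_nonzero hpK
  let P : Polynomial ℂ := aeval (fun i => Polynomial.C (a i) + Polynomial.X * Polynomial.C (b i)
    + q * Polynomial.C (p.rep i)) F
  have hPeval : ∀ s, P.eval s = eval (a + s • b + q.eval s • p.rep) F := by
    intro s
    rw [← Polynomial.coe_aeval_eq_eval, ← aeval_eq_eval]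
    simp only [P]
    rw [← AlgHom.comp_apply, comp_aeval]
    congr 2
    ext i
    simp [mul_comm s]
  have hPdeg : P.natDegree ≤ n * 2 := by
    refine aeval_natDegree_le F hF.totalDegree_le _ fun i => ?_
    compute_degree
    exact max_le one_le_two hq
  have hparT : ∀ t ∈ T, ∃ c s : ℂ, c ≠ 0 ∧ t.rep = c • (a + s • b + q.eval s • p.rep) := by
    intro t ht
    refine (hpar t.rep (hTK t ht)).resolve_left ?_
    rintro ⟨c, hc⟩
    refine hpT ?_
    rwa [← p.mk_rep, ← (Projectivization.mk_eq_mk_iff' ℂ _ _ t.rep_nonzero _).2 ⟨c, hc.symm⟩,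
      t.mk_rep]
  choose! c s hc hs using hparT
  have hP : P = 0 := by
    refine Polynomial.eq_zero_of_natDegree_lt_card_of_eval_eq_zero P (ι := T)
      (f := fun t => s t) (fun t u htu => ?_) (fun t => ?_) (by simp; omega)
    · have ht := hs t t.2
      have hu := hs u u.2
      rw [← (show s t = s u from htu)] at hu
      refine Subtype.ext ?_
      rw [← (t : ProjPlane).mk_rep, ← (u : ProjPlane).mk_rep, Projectivization.mk_eq_mk_iff']
      refine ⟨c t * (c u)⁻¹, ?_⟩
      rw [ht, hu, smul_smul, mul_assoc, inv_mul_cancel₀ (hc u u.2), mul_one]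
    · have h := hTF t t.2
      rw [VanishesAt, hs t t.2, eval_smul_of_isHomogeneous hF] at h
      rw [hPeval]
      exact (mul_eq_zero.1 h).resolve_left (pow_ne_zero n (hc t t.2))
  obtain ⟨f, hf0, hfp⟩ := exists_dual_ne_zero_apply_eq_zero p.rep_nonzero
  have hdvd : K ∣ F * linPoly f := by
    refine hK.dvd_of_forall_eval_eq_zero fun v hv => ?_
    rw [map_mul, eval_linPoly]
    rcases hpar v hv with ⟨c, rfl⟩ | ⟨c, s, -, rfl⟩
    · simp [hfp]
    · rw [eval_smul_of_isHomogeneous hF, ← hPeval, hP]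
      simp
  refine (hK.prime.dvd_or_dvd hdvd).resolve_right fun h => ?_
  have := totalDegree_le_of_dvd_of_isDomain h (linPoly_ne_zero hf0)
  rw [hKh.totalDegree hK.ne_zero, totalDegree_linPoly hf0] at this
  omega

/-- The cofactor of a homogeneous divisor of a homogeneous polynomial can be chosen
homogeneous. -/
lemma exists_homogeneous_cofactor {K F : Poly3} {m n : ℕ} (hK : K.IsHomogeneous m)
    (hF : F.IsHomogeneous n) (hmn : m ≤ n) (h : K ∣ F) :
    ∃ H : Poly3, H.IsHomogeneous (n - m) ∧ F = K * H := by
  let _ := gradedAlgebra (σ := Fin 3) (R := ℂ)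
  obtain ⟨G, rfl⟩ := h
  refine ⟨DirectSum.decompose (homogeneousSubmodule (Fin 3) ℂ) G (n - m),
    (mem_homogeneousSubmodule _ _).1 (SetLike.coe_mem _), ?_⟩
  rw [← DirectSum.coe_decompose_mul_of_left_mem_of_le _ hK hmn,
    DirectSum.decompose_of_mem_same _ hF]

lemma not_dvd_of_isRelPrime {F G : Poly3} (h : IsRelPrime F G) {p : ProjPlane}
    (hF : VanishesAt F p) : ¬ F ∣ G := by
  intro hd
  have := (h dvd_rfl hd).map (eval p.rep)
  rw [hF] at this
  exact not_isUnit_zero this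

end Plane

/-- A `2n`-gon inscribed in an irreducible conic: if two degree-`n` curves with no common
nonconstant factor pass through all `2n` vertices and meet in exactly `n²` distinct
points (the `2n` vertices plus `n² - 2n` further points), then the further intersection
points lie on a curve of degree at most `n - 2`. -/
theorem mystic_2n_gon (n : ℕ) (hn : 3 ≤ n)
    (A : Fin (2 * n) → ProjPlane) (hA : Function.Injective A)
    (K : Poly3) (hKh : K.IsHomogeneous 2) (hKirr : Irreducible K)
    (honK : ∀ i, VanishesAt K (A i))
    (Q₁ Q₂ : Poly3) (h1 : Q₁ ≠ 0) (h2 : Q₂ ≠ 0)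
    (h1h : Q₁.IsHomogeneous n) (h2h : Q₂.IsHomogeneous n)
    (hrel : IsRelPrime Q₁ Q₂)
    (hon1 : ∀ i, VanishesAt Q₁ (A i)) (hon2 : ∀ i, VanishesAt Q₂ (A i))
    (r : Fin (n ^ 2 - 2 * n) → ProjPlane) (hr : Function.Injective r)
    (hdisj : ∀ i j, r i ≠ A j)
    (hzero : zeroSet Q₁ ∩ zeroSet Q₂ = Set.range A ∪ Set.range r) :
    ∃ d ≤ n - 2, ∃ H : Poly3, H ≠ 0 ∧ H.IsHomogeneous d ∧
      ∀ i, VanishesAt H (r i) := by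
  classical
  have hnot : ∀ p, p ∉ Set.range A → VanishesAt K p → VanishesAt Q₁ p → ¬ VanishesAt Q₂ p := by
    intro p hpA hpK hp1 hp2
    let T := insert p (Finset.univ.image A)
    have hT : 2 * n < T.card := by
      rw [Finset.card_insert_of_notMem (by simpa using hpA),
        Finset.card_image_of_injective _ hA, Finset.card_fin]
      omega
    have hall : ∀ F : Poly3, VanishesAt F p → (∀ i, VanishesAt F (A i)) →
        ∀ t ∈ T, VanishesAt F t := by
      intro F hFp hFA t ht
      simp only [T, Finset.mem_insert, Finset.mem_image, Finset.mem_univ, true_and] at ht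
      rcases ht with rfl | ⟨i, rfl⟩
      · exact hFp
      · exact hFA i
    exact hKirr.not_isUnit (hrel
      (conic_dvd_of_card_lt hKh hKirr h1h T hT (hall K hpK honK) (hall Q₁ hp1 hon1))
      (conic_dvd_of_card_lt hKh hKirr h2h T hT (hall K hpK honK) (hall Q₂ hp2 hon2)))
  let i₀ : Fin (2 * n) := ⟨0, by omega⟩
  obtain ⟨x, hxK, hxA⟩ := (infinite_zeroSet hKh hKirr (honK i₀)).exists_notMem_finset
    (Finset.univ.image A)
  have hxA' : x ∉ Set.range A := by simpa using hxA
  set α := eval x.rep Q₁ with hα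
  set β := eval x.rep Q₂ with hβ
  let Q : Poly3 := C β * Q₁ - C α * Q₂
  have hQh : Q.IsHomogeneous n := (h1h.C_mul β).sub (h2h.C_mul α)
  have hQ0 : Q ≠ 0 := by
    intro hQ
    have heq : C β * Q₁ = C α * Q₂ := sub_eq_zero.1 hQ
    by_cases h : α = 0
    · have hβ0 : β ≠ 0 := hnot x hxA' hxK h
      rw [h, C_0, zero_mul] at heq
      exact (mul_ne_zero (C_ne_zero.2 hβ0) h1) heq
    · refine not_dvd_of_isRelPrime hrel (hon1 i₀) ⟨C (α⁻¹ * β), ?_⟩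
      rw [mul_comm, C_mul, mul_assoc, heq, ← mul_assoc, ← C_mul, inv_mul_cancel₀ h, C_1, one_mul]
  have hQ : ∀ p, VanishesAt Q₁ p → VanishesAt Q₂ p → VanishesAt Q p := by
    intro p hp1 hp2
    simp only [VanishesAt] at hp1 hp2
    simp [VanishesAt, Q, hp1, hp2]
  have hKQ : K ∣ Q := by
    refine conic_dvd_of_card_lt hKh hKirr hQh (insert x (Finset.univ.image A)) ?_ ?_ ?_
    · rw [Finset.card_insert_of_notMem hxA, Finset.card_image_of_injective _ hA, Finset.card_fin]
      omega
    · simpa using ⟨hxK, honK⟩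
    · have hxQ : VanishesAt Q x := by
        simp only [VanishesAt, Q, map_sub, map_mul, eval_C, ← hα, ← hβ]
        ring
      simpa using ⟨hxQ, fun i => hQ _ (hon1 i) (hon2 i)⟩
  obtain ⟨H, hH, hQH⟩ := exists_homogeneous_cofactor hKh hQh (by omega) hKQ
  refine ⟨n - 2, le_rfl, H, ?_, hH, fun i => ?_⟩
  · rintro rfl
    exact hQ0 (by rw [hQH, mul_zero])
  · obtain ⟨hr1, hr2⟩ : r i ∈ zeroSet Q₁ ∩ zeroSet Q₂ := hzero ▸ Or.inr ⟨i, rfl⟩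
    have hrA : r i ∉ Set.range A := by
      rintro ⟨j, hj⟩
      exact hdisj i j hj.symm
    have h := hQ _ hr1 hr2
    rw [VanishesAt, hQH, map_mul] at h
    exact (mul_eq_zero.1 h).resolve_left fun hK => hnot _ hrA hK hr1 hr2
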